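/- For every real β > 0, the family indexed by the sigma type Σ (k : ℕ), (Fin k → ℕ) with terms ∏_{i ∈ Fin k} e^{-2πβ(f i + 1)} is summable if and only if β > (log 2)/(2π). -/

import Mathlib

open Real

theorem hasSum_pi_fin_aux {g : ℕ → ℝ} (hg : ∀ n, 0 ≤ g n) {S : ℝ} (h : HasSum g S) (k : ℕ) :
    HasSum (fun f : Fin k → ℕ => ∏ i, g (f i)) (S ^ k) := by
  induction k with
  | zero => simp
  | succ k ih =>
    have hs : Summable (fun x : ℕ × (Fin k → ℕ) => g x.1 * ∏ i, g (x.2 i)) :=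
      Summable.mul_of_nonneg (f := g) (g := fun f : Fin k → ℕ => ∏ i, g (f i))
        h.summable ih.summable (fun n => hg n) (fun f => Finset.prod_nonneg fun i _ => hg (f i))
    have h2 := h.mul ih hs
    rw [← (Fin.consEquiv (fun _ : Fin (k + 1) => ℕ)).hasSum_iff, pow_succ']
    have e : ((fun f : Fin (k + 1) → ℕ => ∏ i, g (f i)) ∘
        (Fin.consEquiv (fun _ : Fin (k + 1) => ℕ))) =
        fun x : ℕ × (Fin k → ℕ) => g x.1 * ∏ i, g (x.2 i) := by
      funext x
      simp [Fin.consEquiv, Fin.prod_univ_succ]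
    rw [e]
    exact h2

/-- The family over `Σ k, (Fin k → ℕ)` with terms `∏_i e^{-2πβ(f i + 1)}`
(the Fock space trace of `e^{-βL^{(1)}}`) is summable iff `β > (log 2)/(2π)`. -/
theorem summable_fock_trace_A1_iff (β : ℝ) (hβ : 0 < β) :
    Summable (fun p : Σ k : ℕ, Fin k → ℕ =>
        ∏ i : Fin p.1, Real.exp (-(2 * π * β) * ((p.2 i : ℝ) + 1)))
      ↔ Real.log 2 / (2 * π) < β := by
  have hc : 0 < 2 * π * β := by positivity
  set q := Real.exp (-(2 * π * β)) with hq
  have hq0 : 0 < q := Real.exp_pos _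
  have hq1 : q < 1 := by rw [hq, Real.exp_lt_one_iff]; linarith
  have hS : HasSum (fun n : ℕ => Real.exp (-(2 * π * β) * ((n : ℝ) + 1))) (q * (1 - q)⁻¹) := by
    have e : (fun n : ℕ => Real.exp (-(2 * π * β) * ((n : ℝ) + 1))) = fun n => q * q ^ n := by
      funext n
      rw [hq, ← Real.exp_nat_mul, ← Real.exp_add]
      ring_nf
    rw [e]
    exact (hasSum_geometric_of_lt_one hq0.le hq1).mul_left q
  have hk := hasSum_pi_fin_aux (fun n => (Real.exp_pos _).le) hS
  rw [summable_sigma_of_nonneg (fun p => Finset.prod_nonneg fun i _ => (Real.exp_pos _).le)]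
  have h1q : 0 < 1 - q := by linarith
  have hS0 : 0 ≤ q * (1 - q)⁻¹ := by positivity
  simp only [fun k => (hk k).tsum_eq]
  rw [and_iff_right (fun k => (hk k).summable), summable_geometric_iff_norm_lt_one,
    Real.norm_of_nonneg hS0, ← div_eq_mul_inv, div_lt_one h1q, div_lt_iff₀ (by positivity)]
  have h2 : q < 1 / 2 ↔ -(2 * π * β) < -Real.log 2 := by
    rw [hq, ← Real.lt_log_iff_exp_lt (by norm_num), one_div, Real.log_inv]
  constructor
  · intro h
    have := h2.1 (by linarith)
    linarith
  · intro h
    have := h2.2 (by linarith)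
    linarith
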